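/- Let n, p ≥ 1, let G be a symmetric p-tensor on ℝ^n, and let s ∈ ℝ^n be nonzero. Then the telescoping identity (Σ_{j=1}^p (−1)^{j+1} binom(p,j) ‖s‖_2^{−2j} P_sym((⊗^j s) ⊗ G[s]^j))[s] = G[s] holds, i.e. the explicit higher-order secant update tensor applied to s reproduces G[s]. -/

import Mathlib

open scoped BigOperators
open Matrix Filter

noncomputable section

/-- A `q`-tensor on `ℝ^n` (a multilinear map `(ℝ^n)^q → ℝ`), represented by its
coefficient array on the standard basis. -/
abbrev Tensor (n q : ℕ) := (Fin q → Fin n) → ℝ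

namespace Tensor

/-- Evaluation of a tensor (as a multilinear map) on the vectors `u 0, …, u (q-1)`. -/
def eval {n q : ℕ} (T : Tensor n q) (u : Fin q → (Fin n → ℝ)) : ℝ :=
  ∑ i : Fin q → Fin n, T i * ∏ k, u k (i k)

/-- A tensor is symmetric if it is invariant under all permutations of its arguments. -/
def Symm {n q : ℕ} (T : Tensor n q) : Prop :=
  ∀ σ : Equiv.Perm (Fin q), ∀ i : Fin q → Fin n, T (i ∘ σ) = T i

/-- The Frobenius norm of a tensor: the Euclidean norm of its coefficient array. -/
def frobNorm {n q : ℕ} (T : Tensor n q) : ℝ :=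
  Real.sqrt (∑ i : Fin q → Fin n, (T i) ^ 2)

/-- The Frobenius inner product of two tensors. -/
def finner {n q : ℕ} (T S : Tensor n q) : ℝ := ∑ i : Fin q → Fin n, T i * S i

/-- The symmetric projection `P_sym(T) = (1/q!) ∑_σ σ(T)`. -/
def psym {n q : ℕ} (T : Tensor n q) : Tensor n q :=
  fun i => ((Nat.factorial q : ℝ))⁻¹ * ∑ σ : Equiv.Perm (Fin q), T (i ∘ σ)

/-- `T[W]^q`: apply the matrix `W` to every argument of `T`. -/
def applyMat {n q : ℕ} (T : Tensor n q) (W : Matrix (Fin n) (Fin n) ℝ) : Tensor n q :=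
  fun j => ∑ i : Fin q → Fin n, T i * ∏ k, W (i k) (j k)

/-- `T[v]^j`: fix the first `j` arguments of `T` to the vector `v`,
yielding a `(q-j)`-tensor. -/
def fixMany {n q : ℕ} (T : Tensor n q) (v : Fin n → ℝ) (j : ℕ) : Tensor n (q - j) :=
  fun idx => ∑ i : Fin j → Fin n, (∏ k, v (i k)) *
    T (fun k => if h : (k : ℕ) < j then i ⟨k, h⟩
        else idx ⟨(k : ℕ) - j, by have hk := k.isLt; omega⟩)

/-- The outer product of two tensors. -/
def outer {n a b : ℕ} (T : Tensor n a) (S : Tensor n b) : Tensor n (a + b) :=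
  fun idx => T (fun k => idx (Fin.castAdd b k)) * S (fun k => idx (Fin.natAdd a k))

/-- Reindexing a tensor along an equality of orders. -/
def castOrder {n a b : ℕ} (h : a = b) (T : Tensor n a) : Tensor n b :=
  fun idx => T (fun k => idx (Fin.cast h k))

/-- Apply a matrix to the first argument of a tensor only. -/
def applyFirst {n q : ℕ} (hq : 0 < q) (T : Tensor n q) (M : Matrix (Fin n) (Fin n) ℝ) :
    Tensor n q :=
  fun idx => ∑ i : Fin n, M i (idx ⟨0, hq⟩) * T (Function.update idx ⟨0, hq⟩ i)

end Tensor

/-- `⊗^j v`, the `j`-fold outer product of a vector `v` with itself. -/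
def vpow {n : ℕ} (j : ℕ) (v : Fin n → ℝ) : Tensor n j := fun idx => ∏ k, v (idx k)

/-- The Euclidean (2-) norm of a vector in `ℝ^n`. -/
def vnorm {n : ℕ} (v : Fin n → ℝ) : ℝ := Real.sqrt (∑ i, v i ^ 2)

/-- The injective (2-) norm of a tensor:
the supremum of `|T[u_1,…,u_q]|` over unit vectors. -/
def Tensor.inj2Norm {n q : ℕ} (T : Tensor n q) : ℝ :=
  sSup ((fun u => |T.eval u|) '' {u : Fin q → Fin n → ℝ | ∀ k, vnorm (u k) = 1})

/-- The spectral (operator 2-) norm of a matrix. -/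
def specNorm {n : ℕ} (M : Matrix (Fin n) (Fin n) ℝ) : ℝ :=
  ‖Matrix.toEuclideanCLM (𝕜 := ℝ) M‖

/-- The orthogonal projection `I - w wᵀ / (wᵀ w)` onto the orthogonal complement of `w`. -/
def projPerp {n : ℕ} (w : Fin n → ℝ) : Matrix (Fin n) (Fin n) ℝ :=
  1 - (w ⬝ᵥ w)⁻¹ • Matrix.vecMulVec w w

/-- `Cp` is a least-change symmetric update of `Cb` in the `W`-weighted Frobenius norm,
subject to the secant equation `Cp[s] = R`. -/
def IsSecantUpdate {n p : ℕ} (Cb : Tensor n p) (R : Tensor n (p - 1))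
    (W : Matrix (Fin n) (Fin n) ℝ) (s : Fin n → ℝ) (Cp : Tensor n p) : Prop :=
  Cp.Symm ∧ Cp.fixMany s 1 = R ∧
    ∀ C : Tensor n p, C.Symm → C.fixMany s 1 = R →
      ((Cp - Cb).applyMat W).frobNorm ≤ ((C - Cb).applyMat W).frobNorm

/-- The explicit higher-order secant update formula of Theorem 1 (b):
`C• + ∑_{j=1}^p (-1)^{j+1} C(p,j) (vᵀs)^{-j} P_sym((⊗^j v) ⊗ (C̃ - C•)[s]^j)`. -/
def hosuFormula {n p : ℕ} (Cb Ct : Tensor n p) (v s : Fin n → ℝ) : Tensor n p :=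
  Cb + ∑ j ∈ (Finset.Icc 1 p).attach,
    ((-1 : ℝ) ^ ((j : ℕ) + 1) * (p.choose (j : ℕ) : ℝ) * ((v ⬝ᵥ s) ^ (j : ℕ))⁻¹) •
      Tensor.castOrder (Nat.add_sub_cancel' (Finset.mem_Icc.mp j.2).2)
        (Tensor.psym ((vpow (j : ℕ) v).outer ((Ct - Cb).fixMany s (j : ℕ))))

/-- The coefficient array of the `q`-th derivative of `f : ℝ^n → ℝ`
(domain given the sup-norm product structure). -/
def derivTensorPi {n : ℕ} (q : ℕ) (f : (Fin n → ℝ) → ℝ) (x : Fin n → ℝ) : Tensor n q :=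
  fun idx => iteratedFDeriv ℝ q f x (fun k => Pi.single (idx k) 1)

/-- The coefficient array of the `q`-th derivative of `f : ℝ^n → ℝ`
(domain given the Euclidean structure). -/
def derivTensorE {n : ℕ} (q : ℕ) (f : EuclideanSpace ℝ (Fin n) → ℝ)
    (x : EuclideanSpace ℝ (Fin n)) : Tensor n q :=
  fun idx => iteratedFDeriv ℝ q f x (fun k => EuclideanSpace.single (idx k) 1)

/-- Reinterpret a Euclidean vector as a plain vector in `Fin n → ℝ`. -/
def toVec {n : ℕ} (y : EuclideanSpace ℝ (Fin n)) : Fin n → ℝ := y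

namespace Tensor

/-- The tensor obtained from `T` by applying the matrix `M` to the arguments in `S`. -/
def applyOn {n q : ℕ} (T : Tensor n q) (M : Matrix (Fin n) (Fin n) ℝ) (S : Finset (Fin q)) :
    Tensor n q :=
  fun i => ∑ a : Fin q → Fin n,
    T a * ∏ k, if k ∈ S then M (a k) (i k) else (1 : Matrix (Fin n) (Fin n) ℝ) (a k) (i k)

theorem applyOn_empty {n q : ℕ} (T : Tensor n q) (M : Matrix (Fin n) (Fin n) ℝ) :
    T.applyOn M ∅ = T := by
  funext i
  simp only [applyOn, Finset.notMem_empty, if_false]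
  rw [Finset.sum_eq_single i]
  · simp
  · intro a _ ha
    obtain ⟨k, hk⟩ := Function.ne_iff.mp ha
    exact mul_eq_zero_of_right _
      (Finset.prod_eq_zero (Finset.mem_univ k) (Matrix.one_apply_ne hk))
  · simp

theorem Symm.applyOn_comp_perm {n q : ℕ} {T : Tensor n q} (hT : T.Symm)
    (M : Matrix (Fin n) (Fin n) ℝ) (S : Finset (Fin q)) (σ : Equiv.Perm (Fin q))
    (i : Fin q → Fin n) :
    T.applyOn M S (i ∘ σ) = T.applyOn M (S.map σ.toEmbedding) i := by
  unfold applyOn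
  refine (Fintype.sum_equiv (Equiv.arrowCongr σ.symm (Equiv.refl _)) _ _ fun a => ?_).symm
  have hcomp : Equiv.arrowCongr σ.symm (Equiv.refl (Fin n)) a = a ∘ σ := by
    funext k; simp [Equiv.arrowCongr]
  rw [hcomp, hT σ a]
  congr 1
  rw [← Equiv.prod_comp σ]
  refine Finset.prod_congr rfl fun k _ => ?_
  simp
  rfl

theorem sum_neg_one_pow_card_applyOn {n q : ℕ} (T : Tensor n q)
    (M : Matrix (Fin n) (Fin n) ℝ) (i : Fin q → Fin n) :
    ∑ S : Finset (Fin q), (-1 : ℝ) ^ S.card * T.applyOn M S i = T.applyMat (1 - M) i := by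
  simp only [applyOn, applyMat, Finset.mul_sum]
  rw [Finset.sum_comm]
  refine Finset.sum_congr rfl fun a _ => ?_
  simp only [Matrix.sub_apply]
  have h := Finset.prod_add (fun k => -M (a k) (i k))
    (fun k => (1 : Matrix (Fin n) (Fin n) ℝ) (a k) (i k)) Finset.univ
  simp only [neg_add_eq_sub, Finset.powerset_univ] at h
  rw [h, Finset.mul_sum]
  refine Finset.sum_congr rfl fun S _ => ?_
  rw [Finset.prod_neg, Finset.prod_ite]
  have h1 : Finset.univ.filter (fun k => k ∈ S) = S := by ext; simp
  have h2 : Finset.univ.filter (fun k => k ∉ S) = Finset.univ \ S := by ext; simp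
  rw [h1, h2]
  ring

theorem Symm.choose_mul_psym_applyOn {n q : ℕ} {T : Tensor n q} (hT : T.Symm)
    (M : Matrix (Fin n) (Fin n) ℝ) (S : Finset (Fin q)) (i : Fin q → Fin n) :
    (q.choose S.card : ℝ) * (T.applyOn M S).psym i
      = ∑ R ∈ Finset.powersetCard S.card Finset.univ, T.applyOn M R i := by
  have hconst : ∀ R ∈ Finset.powersetCard S.card (Finset.univ : Finset (Fin q)),
      (T.applyOn M R).psym i = (T.applyOn M S).psym i := by
    intro R hR
    obtain ⟨τ, rfl⟩ : ∃ τ : Equiv.Perm (Fin q), S.map τ.toEmbedding = R := by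
      have e : {x // x ∈ S} ≃ {x // x ∈ R} :=
        Finset.equivOfCardEq (Finset.mem_powersetCard.mp hR).2.symm
      refine ⟨e.extendSubtype, Finset.eq_of_subset_of_card_le ?_ ?_⟩
      · intro x hx
        obtain ⟨y, hy, rfl⟩ := Finset.mem_map.mp hx
        exact e.extendSubtype_mem y hy
      · rw [Finset.card_map, (Finset.mem_powersetCard.mp hR).2]
    unfold psym
    congr 1
    refine Fintype.sum_equiv (Equiv.mulRight τ) _ _ fun σ => ?_
    rw [← hT.applyOn_comp_perm]
    rfl
  have hsum : ∀ σ : Equiv.Perm (Fin q),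
      ∑ R ∈ Finset.powersetCard S.card Finset.univ, T.applyOn M R (i ∘ σ)
        = ∑ R ∈ Finset.powersetCard S.card Finset.univ, T.applyOn M R i := by
    intro σ
    simp only [hT.applyOn_comp_perm]
    refine Finset.sum_equiv σ.finsetCongr (fun R => ?_) fun R _ => ?_
    · simp [Finset.mem_powersetCard]
    · simp
  calc (q.choose S.card : ℝ) * (T.applyOn M S).psym i
      = ∑ R ∈ Finset.powersetCard S.card Finset.univ, (T.applyOn M R).psym i := by
        rw [Finset.sum_congr rfl hconst]; simp
    _ = ((Nat.factorial q : ℝ))⁻¹ * ∑ σ : Equiv.Perm (Fin q),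
          ∑ R ∈ Finset.powersetCard S.card Finset.univ, T.applyOn M R (i ∘ σ) := by
        unfold psym
        rw [← Finset.mul_sum, Finset.sum_comm]
    _ = _ := by
        simp only [hsum]
        have := Nat.factorial_ne_zero q
        simp [Fintype.card_perm]
        field_simp

theorem castOrder_psym {n a b : ℕ} (h : a = b) (T : Tensor n a) :
    castOrder h T.psym = (castOrder h T).psym := by
  subst h; rfl

theorem castOrder_vpow_outer_fixMany {n q j : ℕ} (T : Tensor n q) (s : Fin n → ℝ) (c : ℝ)
    (hj : j + (q - j) = q) :
    c ^ j • castOrder hj ((vpow j s).outer (T.fixMany s j))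
      = T.applyOn (c • Matrix.vecMulVec s s) (Finset.univ.filter fun k : Fin q => (k : ℕ) < j) := by
  obtain ⟨m, rfl⟩ : ∃ m, q = j + m := ⟨q - j, hj.symm⟩
  funext i
  simp only [applyOn, Pi.smul_apply, smul_eq_mul, castOrder, outer, vpow, fixMany]
  rw [← (Fin.appendEquiv j m).sum_comp, Fintype.sum_prod_type]
  simp only [Finset.mul_sum]
  refine Finset.sum_congr rfl fun b _ => ?_
  rw [Finset.sum_eq_single (fun k => i (Fin.natAdd j k))]
  · rw [Fin.prod_univ_add]
    have happ : (fun k : Fin (j + m) => if h : (k : ℕ) < j then b ⟨k, h⟩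
        else i (Fin.cast hj (Fin.natAdd j ⟨(k : ℕ) - j, by have hk := k.isLt; omega⟩)))
        = Fin.append b fun k => i (Fin.natAdd j k) := by
      funext k
      refine Fin.addCases (fun k => ?_) (fun k => ?_) k
      · simp
      · simp
        rfl
    have hequiv : Fin.appendEquiv j m (b, fun k => i (Fin.natAdd j k))
        = Fin.append b fun k => i (Fin.natAdd j k) := rfl
    have hone : ∀ k : Fin m,
        (1 : Matrix (Fin n) (Fin n) ℝ)
          (Fin.append b (fun k => i (Fin.natAdd j k)) (Fin.natAdd j k)) (i (Fin.natAdd j k)) = 1 :=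
      fun k => by rw [Fin.append_right, Matrix.one_apply_eq]
    have hcast : ∀ k : Fin j, Fin.cast hj (Fin.castAdd (j + m - j) k) = Fin.castAdd m k :=
      fun k => rfl
    rw [happ, hequiv]
    simp only [Finset.mem_filter, Finset.mem_univ, true_and, Fin.val_castAdd, Fin.is_lt, if_true,
      Fin.val_natAdd, Nat.not_lt.mpr (Nat.le_add_right _ _), if_false, Fin.append_left,
      Fin.append_right, Matrix.smul_apply, Matrix.vecMulVec_apply, smul_eq_mul,
      Finset.prod_mul_distrib, Finset.prod_const, Finset.card_univ, Fintype.card_fin, hcast]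
    rw [Finset.prod_congr rfl fun k _ => hone k, Finset.prod_const_one]
    ring
  · intro d _ hd
    obtain ⟨k, hk⟩ := Function.ne_iff.mp hd
    rw [Finset.prod_eq_zero (Finset.mem_univ (Fin.natAdd j k)), mul_zero]
    rw [if_neg (by simp)]
    refine Matrix.one_apply_ne ?_
    simpa only [Fin.appendEquiv, Equiv.coe_fn_mk, Fin.append_right] using hk
  · simp

theorem Symm.choose_smul_psym_vpow_outer_fixMany {n q j : ℕ} {T : Tensor n q} (hT : T.Symm)
    (s : Fin n → ℝ) (c : ℝ) (hj : j + (q - j) = q) :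
    ((q.choose j : ℝ) * c ^ j) • castOrder hj ((vpow j s).outer (T.fixMany s j)).psym
      = ∑ S ∈ Finset.powersetCard j Finset.univ, T.applyOn (c • Matrix.vecMulVec s s) S := by
  funext i
  have hcard : (Finset.univ.filter fun k : Fin q => (k : ℕ) < j).card = j := by
    rw [Fin.card_filter_val_lt]; omega
  have h := hT.choose_mul_psym_applyOn (c • Matrix.vecMulVec s s)
    (Finset.univ.filter fun k : Fin q => (k : ℕ) < j) i
  rw [hcard, ← castOrder_vpow_outer_fixMany T s c hj] at h
  rw [Finset.sum_apply, ← h, castOrder_psym]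
  simp only [psym, Pi.smul_apply, smul_eq_mul, ← Finset.mul_sum]
  ring

theorem fixMany_one_applyMat_eq_zero {n q : ℕ} (hq : 0 < q) (T : Tensor n q) (s : Fin n → ℝ)
    (M : Matrix (Fin n) (Fin n) ℝ) (hM : M *ᵥ s = 0) : (T.applyMat M).fixMany s 1 = 0 := by
  obtain ⟨m, rfl⟩ : ∃ m, q = m + 1 := ⟨q - 1, by omega⟩
  funext idx
  simp only [fixMany, applyMat, Finset.mul_sum, Pi.zero_apply]
  rw [Finset.sum_comm]
  refine Finset.sum_eq_zero fun a _ => ?_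
  have h0 : ∑ x, M (a 0) x * s x = 0 := congrFun hM (a 0)
  rw [← (Equiv.funUnique (Fin 1) (Fin n)).symm.sum_comp]
  simp only [Fin.prod_univ_succ]
  simp
  calc _ = ∑ x, (M (a 0) x * s x) * (T a * ∏ k : Fin m, M (a k.succ) (idx k)) := by
        refine Finset.sum_congr rfl fun x _ => ?_
        ring_nf
    _ = 0 := by rw [← Finset.sum_mul, h0, zero_mul]

theorem fixMany_sub {n q : ℕ} (T U : Tensor n q) (s : Fin n → ℝ) (j : ℕ) :
    (T - U).fixMany s j = T.fixMany s j - U.fixMany s j := by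
  funext idx
  simp [fixMany, mul_sub]

theorem Symm.sum_choose_psym_eq_sub_applyMat {n p : ℕ} {G : Tensor n p} (hG : G.Symm)
    (s : Fin n → ℝ) (c : ℝ) :
    ∑ j ∈ (Finset.Icc 1 p).attach,
        ((-1 : ℝ) ^ ((j : ℕ) + 1) * (p.choose (j : ℕ) : ℝ) * c ^ (j : ℕ)) •
          castOrder (Nat.add_sub_cancel' (Finset.mem_Icc.mp j.2).2)
            (psym ((vpow (j : ℕ) s).outer (G.fixMany s (j : ℕ))))
      = G - G.applyMat (1 - c • Matrix.vecMulVec s s) := by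
  simp only [mul_assoc, mul_smul ((-1 : ℝ) ^ _), hG.choose_smul_psym_vpow_outer_fixMany]
  rw [Finset.sum_attach (Finset.Icc 1 p) fun j => (-1 : ℝ) ^ (j + 1) •
    ∑ S ∈ Finset.powersetCard j Finset.univ, G.applyOn (c • Matrix.vecMulVec s s) S]
  funext i
  rw [Pi.sub_apply, ← sum_neg_one_pow_card_applyOn, ← Finset.powerset_univ,
    Finset.sum_powerset, Finset.card_univ, Fintype.card_fin, Finset.range_eq_Ico,
    Finset.sum_eq_sum_Ico_succ_bot (Nat.succ_pos p)]
  have hbot : ∑ S ∈ Finset.powersetCard 0 (Finset.univ : Finset (Fin p)),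
      (-1 : ℝ) ^ S.card * G.applyOn (c • Matrix.vecMulVec s s) S i = G i := by
    simp [applyOn_empty]
  rw [hbot, sub_add_cancel_left, ← Finset.sum_neg_distrib, Finset.sum_apply]
  refine Finset.sum_congr rfl fun j _ => ?_
  rw [Pi.smul_apply, Finset.sum_apply, smul_eq_mul, Finset.mul_sum, ← Finset.sum_neg_distrib]
  refine Finset.sum_congr rfl fun S hS => ?_
  rw [(Finset.mem_powersetCard.mp hS).2]
  ring

end Tensor

theorem vnorm_sq {n : ℕ} (s : Fin n → ℝ) : vnorm s ^ 2 = s ⬝ᵥ s := by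
  rw [vnorm, Real.sq_sqrt (Finset.sum_nonneg fun i _ => sq_nonneg (s i))]
  simp [dotProduct, sq]

/-- the telescoping identity — the explicit higher-order secant update
tensor applied to `s` reproduces `G[s]`. -/
theorem statement4 (n p : ℕ) (hn : 1 ≤ n) (hp : 1 ≤ p)
    (G : Tensor n p) (hG : G.Symm) (s : Fin n → ℝ) (hs : s ≠ 0) :
    (∑ j ∈ (Finset.Icc 1 p).attach,
        ((-1 : ℝ) ^ ((j : ℕ) + 1) * (p.choose (j : ℕ) : ℝ) * (vnorm s ^ (2 * (j : ℕ)))⁻¹) •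
          Tensor.castOrder (Nat.add_sub_cancel' (Finset.mem_Icc.mp j.2).2)
            (Tensor.psym ((vpow (j : ℕ) s).outer (G.fixMany s (j : ℕ))))).fixMany s 1
      = G.fixMany s 1 := by
  simp only [pow_mul, vnorm_sq, ← inv_pow]
  rw [hG.sum_choose_psym_eq_sub_applyMat, Tensor.fixMany_sub,
    Tensor.fixMany_one_applyMat_eq_zero hp, sub_zero]
  have hss : s ⬝ᵥ s ≠ 0 := by simpa using hs
  rw [Matrix.sub_mulVec, Matrix.one_mulVec, Matrix.smul_mulVec, Matrix.vecMulVec_mulVec]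
  funext k
  simp
  field_simp
  simp
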